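/- arXiv:1611.03584 — 7 statements merged into one kernel-verified Lean document; each statement's English description precedes it below -/
import Mathlib

section
/- Let N ≥ 1 be an integer, let λ > 0, let α, β be real numbers with 0 < α < β ≤ 1, and let T, A, B be real numbers satisfying T + A − λB = 0 and ((N−2)/(2N))T + (1/(α+1))A − λ(1/(β+1))B = 0. Then T + αA − λβB = T·(N(1−α)(1−β) − 2(1+α)(1+β))/(2N). In particular, if 2(1+α)(1+β) = N(1−α)(1−β), then T + αA − λβB = 0. -/
/-- If `T + A - λB = 0` (Nehari) and `((N-2)/(2N))T + A/(1+α) - λB/(1+β) = 0`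
(Pohozaev for a flat solution), then the second fibering derivative satisfies
`T + αA - λβB = T(N(1-α)(1-β) - 2(1+α)(1+β))/(2N)`; in particular it vanishes
on the critical exponent curve. -/
theorem stmt_1 (N : ℕ) (hN : 1 ≤ N) (lam α β : ℝ) (hlam : 0 < lam)
    (hα : 0 < α) (hαβ : α < β) (hβ : β ≤ 1) (T A B : ℝ)
    (hNehari : T + A - lam * B = 0)
    (hPohozaev : ((N : ℝ) - 2) / (2 * N) * T + 1 / (α + 1) * A - lam * (1 / (β + 1)) * B = 0) :
    T + α * A - lam * β * B
      = T * ((N : ℝ) * (1 - α) * (1 - β) - 2 * (1 + α) * (1 + β)) / (2 * N) ∧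
    (2 * (1 + α) * (1 + β) = (N : ℝ) * (1 - α) * (1 - β) →
      T + α * A - lam * β * B = 0) := by
  have hN₀ : (N : ℝ) ≠ 0 := by positivity
  have hα₀ : α + 1 ≠ 0 := by positivity
  have hβ₀ : β + 1 ≠ 0 := by
    have : 0 < β := hα.trans hαβ
    positivity
  have identity : T + α * A - lam * β * B
      = T * ((N : ℝ) * (1 - α) * (1 - β) - 2 * (1 + α) * (1 + β)) / (2 * N) := by
    linear_combination (norm := skip)
      (1 + α + β) * hNehari - (α + 1) * (β + 1) * hPohozaev
    field_simp
    ring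
  refine ⟨identity, fun hcrit => ?_⟩
  rw [identity, hcrit, sub_self, mul_zero, zero_div]
end

section
/- Let N ≥ 1 be an integer, let λ > 0, let α, β be real numbers with 0 < α < β ≤ 1 and 2(1+α)(1+β) − N(1−α)(1−β) > 0, and let T, A, B be real numbers with T > 0 satisfying T + A − λB = 0 and ((N−2)/(2N))T + (1/(α+1))A − λ(1/(β+1))B = 0. Then T + αA − λβB < 0. -/
/-- If `(α,β)` lies in `E_u(N)` and `T > 0` satisfies the Nehari and Pohozaev
identities, then the second fibering derivative `T + αA - λβB` is negative. -/
theorem stmt_2 (N : ℕ) (hN : 1 ≤ N) (lam α β : ℝ) (hlam : 0 < lam)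
    (hα : 0 < α) (hαβ : α < β) (hβ : β ≤ 1)
    (hcrit : 0 < 2 * (1 + α) * (1 + β) - (N : ℝ) * (1 - α) * (1 - β))
    (T A B : ℝ) (hT : 0 < T)
    (hNehari : T + A - lam * B = 0)
    (hPohozaev : ((N : ℝ) - 2) / (2 * N) * T + 1 / (α + 1) * A - lam * (1 / (β + 1)) * B = 0) :
    T + α * A - lam * β * B < 0 := by
  have hN' : (0 : ℝ) < N := by exact_mod_cast hN
  have hα1 : α + 1 ≠ 0 := by linarith
  have hβ1 : β + 1 ≠ 0 := by linarith
  have hcleared : ((N : ℝ) - 2) * (α + 1) * (β + 1) * T + 2 * N * (β + 1) * A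
      - 2 * N * (α + 1) * (lam * B) = 0 := by
    have hmul : 2 * (N : ℝ) * (α + 1) * (β + 1) * (((N : ℝ) - 2) / (2 * N) * T
        + 1 / (α + 1) * A - lam * (1 / (β + 1)) * B) = 0 := by rw [hPohozaev, mul_zero]
    rw [← hmul]
    field_simp
  have hkey : 2 * (N : ℝ) * (T + α * A - lam * β * B)
      = -(T * (2 * (1 + α) * (1 + β) - (N : ℝ) * (1 - α) * (1 - β))) := by
    linear_combination 2 * (N : ℝ) * (α + β + 1) * hNehari - hcleared
  have hprod := mul_pos hT hcrit
  by_contra! hnonneg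
  have := mul_nonneg (by positivity : (0 : ℝ) ≤ 2 * N) hnonneg
  linarith
end

section
/- Let N ≥ 1 be an integer, let λ > 0, let α, β be real numbers with 0 < α < β ≤ 1 and 2(1+α)(1+β) − N(1−α)(1−β) < 0, and let T, A, B be real numbers with T > 0, A ≥ 0, B ≥ 0, satisfying T + A − λB = 0 and ((N−2)/(2N))T + (1/(α+1))A − λ(1/(β+1))B ≤ 0. Then T + αA − λβB > 0. -/
/-- If `(α,β)` lies in `E_s(N)` and `T > 0`, `A, B ≥ 0` satisfy the Nehari
identity and the Pohozaev inequality, then the second fibering derivative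
`T + αA - λβB` is positive. -/
theorem stmt_3 (N : ℕ) (hN : 1 ≤ N) (lam α β : ℝ) (hlam : 0 < lam)
    (hα : 0 < α) (hαβ : α < β) (hβ : β ≤ 1)
    (hcrit : 2 * (1 + α) * (1 + β) - (N : ℝ) * (1 - α) * (1 - β) < 0)
    (T A B : ℝ) (hT : 0 < T) (hA : 0 ≤ A) (hB : 0 ≤ B)
    (hNehari : T + A - lam * B = 0)
    (hPohozaev : ((N : ℝ) - 2) / (2 * N) * T + 1 / (α + 1) * A - lam * (1 / (β + 1)) * B ≤ 0) :
    0 < T + α * A - lam * β * B := by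
  have hNpos : (0 : ℝ) < N := by exact_mod_cast hN
  have hα1 : 0 < α + 1 := by linarith
  have hβ1 : 0 < β + 1 := by linarith
  have hlamB : lam * B = T + A := by linarith
  have hcleared :
      T * (1 + α) * (((N : ℝ) - 2) * (1 + β) - 2 * N) + 2 * N * A * (β - α) ≤ 0 := by
    have hscaled := mul_nonpos_of_nonneg_of_nonpos
      (by positivity : 0 ≤ 2 * (N : ℝ) * (α + 1) * (β + 1)) hPohozaev
    have hexpand : 2 * (N : ℝ) * (α + 1) * (β + 1) *
        (((N : ℝ) - 2) / (2 * N) * T + 1 / (α + 1) * A - lam * (1 / (β + 1)) * B) =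
        ((N : ℝ) - 2) * T * (α + 1) * (β + 1) + 2 * N * (β + 1) * A
          - 2 * N * (α + 1) * (lam * B) := by
      field_simp
    rw [hexpand, hlamB] at hscaled
    linarith
  have hgap := mul_neg_of_pos_of_neg hT hcrit
  have hpos : 0 < 2 * (N : ℝ) * (T * (1 - β) - (β - α) * A) := by linarith
  have hfiber : T + α * A - lam * β * B = T * (1 - β) - (β - α) * A := by
    linear_combination -β * hlamB
  rw [hfiber]
  exact pos_of_mul_pos_right hpos (by positivity)
end

section
/- Let T, A, B, λ be positive real numbers and let α, β be real numbers with 0 < α < β < 1. Then the set { r ∈ ℝ : r > 0 and r·T + r^α·A − λ·r^β·B = 0 } has at most two elements. -/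
theorem Set.exists_subset_pair_of_no_three_lt {ι : Type*} [LinearOrder ι] [Nonempty ι]
    {S : Set ι} (h : ∀ x ∈ S, ∀ y ∈ S, ∀ z ∈ S, x < y → ¬ y < z) :
    ∃ a b, S ⊆ {a, b} := by
  by_cases hS : ∃ a ∈ S, ∃ b ∈ S, a < b
  · obtain ⟨a, ha, b, hb, hab⟩ := hS
    refine ⟨a, b, fun c hc => ?_⟩
    rcases lt_trichotomy c a with hca | rfl | hac
    · exact absurd hab (h c hc a ha b hb hca)
    · simp
    rcases lt_trichotomy c b with hcb | rfl | hbc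
    · exact absurd hcb (h a ha c hc b hb hac)
    · simp
    · exact absurd hbc (h a ha b hb c hc hab)
  · push Not at hS
    rcases S.eq_empty_or_nonempty with rfl | ⟨a, ha⟩
    · exact ⟨Classical.arbitrary ι, Classical.arbitrary ι, Set.empty_subset _⟩
    · exact ⟨a, a, fun c hc => by simp [le_antisymm (hS a ha c hc) (hS c hc a ha)]⟩

/-- A strictly convex function agrees with an affine one in at most two points. -/
theorem StrictConvexOn.not_three_eq_affine {s : Set ℝ} {f : ℝ → ℝ} (hf : StrictConvexOn ℝ s f)
    {m c x y z : ℝ} (hx : x ∈ s) (hz : z ∈ s) (hxy : x < y) (hyz : y < z)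
    (hfx : f x = m * x + c) (hfy : f y = m * y + c) (hfz : f z = m * z + c) : False := by
  have h := hf.slope_strict_mono_adjacent hx hz hxy hyz
  have h1 : (f y - f x) / (y - x) = m := by
    rw [hfx, hfy, div_eq_iff (sub_pos.2 hxy).ne']; ring
  have h2 : (f z - f y) / (z - y) = m := by
    rw [hfy, hfz, div_eq_iff (sub_pos.2 hyz).ne']; ring
  exact absurd h (by rw [h1, h2]; exact lt_irrefl m)

/-- In the variable `r ^ (β - α)` the positive roots are the points where a power function
meets an affine one. -/
theorem rpow_eq_affine_of_root {T A B lam α β r : ℝ} (hT : T ≠ 0) (hαβ : α < β) (hr : 0 < r)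
    (h : r * T + r ^ α * A - lam * r ^ β * B = 0) :
    (r ^ (β - α)) ^ ((1 - α) / (β - α)) = lam * B / T * r ^ (β - α) + -A / T := by
  rw [← Real.rpow_mul hr.le, mul_div_cancel₀ _ (sub_pos.2 hαβ).ne', Real.rpow_sub hr,
    Real.rpow_sub hr, Real.rpow_one]
  have hrα : r ^ α ≠ 0 := (Real.rpow_pos_of_pos hr α).ne'
  field_simp
  linarith

/-- The derivative `Φ'_u(r) = rT + r^α A - λ r^β B` of the fibering map has at
most two positive roots when `0 < α < β < 1`. -/
theorem stmt_6 (T A B lam α β : ℝ) (hT : 0 < T) (hA : 0 < A) (hB : 0 < B)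
    (hlam : 0 < lam) (hα : 0 < α) (hαβ : α < β) (hβ : β < 1) :
    ∃ a b : ℝ,
      {r : ℝ | 0 < r ∧ r * T + r ^ α * A - lam * r ^ β * B = 0} ⊆ {a, b} := by
  have hd : 0 < β - α := sub_pos.2 hαβ
  have hp : 1 < (1 - α) / (β - α) := by rw [one_lt_div hd]; linarith
  refine Set.exists_subset_pair_of_no_three_lt ?_
  rintro x ⟨hx, hx0⟩ y ⟨hy, hy0⟩ z ⟨hz, hz0⟩ hxy hyz
  exact (strictConvexOn_rpow hp).not_three_eq_affine
    (Real.rpow_nonneg hx.le _) (Real.rpow_nonneg hz.le _)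
    (Real.rpow_lt_rpow hx.le hxy hd) (Real.rpow_lt_rpow hy.le hyz hd)
    (rpow_eq_affine_of_root hT.ne' hαβ hx hx0) (rpow_eq_affine_of_root hT.ne' hαβ hy hy0)
    (rpow_eq_affine_of_root hT.ne' hαβ hz hz0)
end

section
/- Let T, A, B, λ be positive real numbers, let α, β be real numbers with 0 < α < β < 1, and define φ(r) = r·T + r^α·A − λ·r^β·B for r > 0. If 0 < r₁ < r₂ and φ(r₁) = φ(r₂) = 0, then the derivative of φ satisfies φ'(r₁) < 0 and φ'(r₂) > 0, where φ'(r) = T + α r^{α−1} A − λ β r^{β−1} B. -/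
/-- The sign of the derivative of `r * T + r ^ α * A - lam * r ^ β * B` at a root `r`, read off
from the position of another root `r'`. -/
theorem fibering_deriv_mul_log_neg {T A B lam α β r r' : ℝ} (hT : 0 < T) (hA : 0 < A)
    (hαβ : α < β) (hβ : β < 1) (hr : 0 < r) (hr' : 0 < r') (hne : r ≠ r')
    (hz : r * T + r ^ α * A - lam * r ^ β * B = 0)
    (hz' : r' * T + r' ^ α * A - lam * r' ^ β * B = 0) :
    (T + α * r ^ (α - 1) * A - lam * β * r ^ (β - 1) * B) * (Real.log r' - Real.log r) < 0 := by
  set t := Real.log r' - Real.log r with ht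
  have ht0 : t ≠ 0 := fun h ↦
    hne (Real.log_injOn_pos hr hr' (sub_eq_zero.mp h).symm)
  have hscale (γ : ℝ) : r' ^ γ = r ^ γ * Real.exp (γ * t) := by
    rw [Real.rpow_def_of_pos hr, Real.rpow_def_of_pos hr', ← Real.exp_add, ht]
    ring_nf
  have hscale_one : r' = r * Real.exp t := by simpa using hscale 1
  have hkey : r * T * Real.exp ((1 - β) * t) + r ^ α * A * Real.exp ((α - β) * t)
      = r * T + r ^ α * A := by
    have h1 : Real.exp t = Real.exp ((1 - β) * t) * Real.exp (β * t) := by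
      rw [← Real.exp_add]; ring_nf
    have h2 : Real.exp (α * t) = Real.exp ((α - β) * t) * Real.exp (β * t) := by
      rw [← Real.exp_add]; ring_nf
    rw [hscale α, hscale β, hscale_one, h1, h2] at hz'
    refine mul_right_cancel₀ (Real.exp_pos (β * t)).ne' ?_
    linear_combination hz' - Real.exp (β * t) * hz
  have hlt : r * T * ((1 - β) * t + 1) + r ^ α * A * ((α - β) * t + 1)
      < r * T + r ^ α * A := by
    have h1 := Real.add_one_lt_exp (mul_ne_zero (sub_pos.mpr hβ).ne' ht0)
    have h2 := Real.add_one_lt_exp (mul_ne_zero (sub_neg.mpr hαβ).ne ht0)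
    rw [← hkey]
    gcongr
  have hderiv : r * (T + α * r ^ (α - 1) * A - lam * β * r ^ (β - 1) * B)
      = (1 - β) * (r * T) + (α - β) * (r ^ α * A) := by
    have h1 : r * r ^ (α - 1) = r ^ α := by
      rw [Real.rpow_sub_one hr.ne', mul_div_cancel₀ _ hr.ne']
    have h2 : r * r ^ (β - 1) = r ^ β := by
      rw [Real.rpow_sub_one hr.ne', mul_div_cancel₀ _ hr.ne']
    linear_combination α * A * h1 - lam * β * B * h2 + β * hz
  refine neg_of_mul_neg_right (a := r) ?_ hr.le
  rw [← mul_assoc, hderiv]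
  linarith

/-- The derivative of `r * T + r ^ α * A - lam * r ^ β * B` away from zero. -/
theorem hasDerivAt_fibering (T A B lam α β : ℝ) {r : ℝ} (hr : r ≠ 0) :
    HasDerivAt (fun r : ℝ ↦ r * T + r ^ α * A - lam * r ^ β * B)
      (T + α * r ^ (α - 1) * A - lam * β * r ^ (β - 1) * B) r := by
  have h := (((hasDerivAt_id r).mul_const T).add
    ((Real.hasDerivAt_rpow_const (p := α) (Or.inl hr)).mul_const A)).sub
    (((Real.hasDerivAt_rpow_const (p := β) (Or.inl hr)).const_mul lam).mul_const B)
  exact h.congr_deriv (by ring)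

/-- If the fibering derivative `φ(r) = rT + r^α A - λ r^β B` has two distinct
positive roots `r₁ < r₂`, then `φ'(r₁) < 0 < φ'(r₂)`, where
`φ'(r) = T + α r^(α-1) A - λ β r^(β-1) B`. -/
theorem stmt_7 (T A B lam α β : ℝ) (hT : 0 < T) (hA : 0 < A) (hB : 0 < B)
    (hlam : 0 < lam) (hα : 0 < α) (hαβ : α < β) (hβ : β < 1)
    (φ : ℝ → ℝ) (hφ : ∀ r, φ r = r * T + r ^ α * A - lam * r ^ β * B)
    (r₁ r₂ : ℝ) (hr₁ : 0 < r₁) (hr₁₂ : r₁ < r₂)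
    (hz₁ : φ r₁ = 0) (hz₂ : φ r₂ = 0) :
    (HasDerivAt φ (T + α * r₁ ^ (α - 1) * A - lam * β * r₁ ^ (β - 1) * B) r₁ ∧
      T + α * r₁ ^ (α - 1) * A - lam * β * r₁ ^ (β - 1) * B < 0) ∧
    (HasDerivAt φ (T + α * r₂ ^ (α - 1) * A - lam * β * r₂ ^ (β - 1) * B) r₂ ∧
      0 < T + α * r₂ ^ (α - 1) * A - lam * β * r₂ ^ (β - 1) * B) := by
  obtain rfl : φ = fun r ↦ r * T + r ^ α * A - lam * r ^ β * B := funext hφ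
  have hr₂ : 0 < r₂ := hr₁.trans hr₁₂
  have hlog : Real.log r₁ < Real.log r₂ := Real.log_lt_log hr₁ hr₁₂
  refine ⟨⟨hasDerivAt_fibering T A B lam α β hr₁.ne', ?_⟩,
    hasDerivAt_fibering T A B lam α β hr₂.ne', ?_⟩
  · exact neg_of_mul_neg_left
      (fibering_deriv_mul_log_neg hT hA hαβ hβ hr₁ hr₂ hr₁₂.ne hz₁ hz₂) (sub_pos.mpr hlog).le
  · exact pos_of_mul_neg_left
      (fibering_deriv_mul_log_neg hT hA hαβ hβ hr₂ hr₁ hr₁₂.ne' hz₂ hz₁) (sub_neg.mpr hlog).le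
end

section
/- Let α, β, λ be real numbers with 0 < α < β ≤ 1 and λ > 0, and set u_∞ = λ^{−1/(β−α)}. Let v : [0,∞) → ℝ be differentiable with v(t) ≥ 0 for all t ≥ 0, satisfying v'(t) = λ·v(t)^β − v(t)^α for all t ≥ 0, and with v(0) < u_∞. Then there exists T₀ ≥ 0 such that v(t) = 0 for all t ≥ T₀; in particular v(t) → 0 as t → ∞. -/
/-- A function with nonpositive derivative on `[0, ∞)` is antitone there. -/
theorem antitoneOn_Ici_of_hasDerivAt_nonpos {f f' : ℝ → ℝ}
    (hf : ∀ t, 0 ≤ t → HasDerivAt f (f' t) t) (hf' : ∀ t, 0 ≤ t → f' t ≤ 0) :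
    AntitoneOn f (Set.Ici 0) := by
  refine antitoneOn_of_deriv_nonpos (convex_Ici 0)
    (fun t ht => (hf t ht).continuousAt.continuousWithinAt) ?_ ?_
  · intro t ht
    exact (hf t (interior_subset ht)).differentiableAt.differentiableWithinAt
  · intro t ht
    rw [(hf t (interior_subset ht)).deriv]
    exact hf' t (interior_subset ht)

/-- Below a level `M`, the reaction term is dominated by a multiple of the absorption term. -/
theorem mul_rpow_sub_rpow_le {α β lam M x : ℝ} (hα : 0 < α) (hαβ : α < β) (hlam : 0 < lam)
    (hx : 0 ≤ x) (hxM : x ≤ M) :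
    lam * x ^ β - x ^ α ≤ -(1 - lam * M ^ (β - α)) * x ^ α := by
  have hsplit : x ^ β = x ^ (β - α) * x ^ α := by
    rw [← Real.rpow_add_of_nonneg hx (by linarith) hα.le]
    congr 1
    ring
  have hmono : x ^ (β - α) ≤ M ^ (β - α) := Real.rpow_le_rpow hx hxM (by linarith)
  have h := mul_le_mul_of_nonneg_right (mul_le_mul_of_nonneg_left hmono hlam.le)
    (Real.rpow_nonneg hx α)
  rw [hsplit]
  linarith

/-- The differential inequality `v' ≤ -c v^α` with `c > 0` and `α < 1` forces a nonnegative
function to vanish somewhere. -/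
theorem exists_eq_zero_of_deriv_le_neg_rpow {α c : ℝ} (hα : α < 1) (hc : 0 < c) {v v' : ℝ → ℝ}
    (hnonneg : ∀ t, 0 ≤ t → 0 ≤ v t) (hv : ∀ t, 0 ≤ t → HasDerivAt v (v' t) t)
    (hv' : ∀ t, 0 ≤ t → v' t ≤ -c * v t ^ α) :
    ∃ T, 0 ≤ T ∧ v T = 0 := by
  by_contra! hne
  have hpos : ∀ t, 0 ≤ t → 0 < v t := fun t ht => (hnonneg t ht).lt_of_ne' (hne t ht)
  set k := (1 - α) * c with hk
  have hkpos : 0 < k := mul_pos (by linarith) hc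
  have hanti : AntitoneOn (fun t => v t ^ (1 - α) + k * t) (Set.Ici 0) := by
    refine antitoneOn_Ici_of_hasDerivAt_nonpos (fun t ht =>
      ((hv t ht).rpow_const (Or.inl (hne t ht))).add ((hasDerivAt_id t).const_mul k)) ?_
    intro t ht
    have hcancel : v t ^ α * v t ^ (1 - α - 1) = 1 := by
      rw [← Real.rpow_add (hpos t ht)]
      simp
    have h := mul_le_mul_of_nonneg_right (hv' t ht)
      (mul_nonneg (sub_nonneg.2 hα.le) (Real.rpow_nonneg (hpos t ht).le (1 - α - 1)))
    have hrhs : -c * v t ^ α * ((1 - α) * v t ^ (1 - α - 1)) = -k := by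
      rw [hk]
      linear_combination (-c * (1 - α)) * hcancel
    rw [hrhs] at h
    linarith
  have hw : 0 ≤ v 0 ^ (1 - α) := Real.rpow_nonneg (hnonneg 0 le_rfl) _
  have hT : 0 ≤ v 0 ^ (1 - α) / k + 1 := by positivity
  have h := hanti (Set.mem_Ici.2 le_rfl) (Set.mem_Ici.2 hT) hT
  have hwT := Real.rpow_nonneg (hnonneg _ hT) (1 - α)
  have hcalc : k * (v 0 ^ (1 - α) / k + 1) = v 0 ^ (1 - α) + k := by
    field_simp
  simp only [hcalc, mul_zero] at h
  linarith

/-- For the ODE `v' = λ v^β - v^α` with `0 < α < β ≤ 1`, any nonnegative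
solution starting strictly below the nontrivial equilibrium `λ^(-1/(β-α))`
vanishes after a finite time; in particular it tends to `0`. -/
theorem stmt_9 (α β lam : ℝ) (hα : 0 < α) (hαβ : α < β) (hβ : β ≤ 1)
    (hlam : 0 < lam) (v : ℝ → ℝ)
    (hnonneg : ∀ t, 0 ≤ t → 0 ≤ v t)
    (hode : ∀ t, 0 ≤ t → HasDerivAt v (lam * v t ^ β - v t ^ α) t)
    (hinit : v 0 < lam ^ (-(1 / (β - α)))) :
    (∃ T₀ : ℝ, 0 ≤ T₀ ∧ ∀ t, T₀ ≤ t → v t = 0) ∧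
    Filter.Tendsto v Filter.atTop (nhds 0) := by
  have hd : 0 < β - α := sub_pos.2 hαβ
  obtain ⟨M, hvM, hMu⟩ := exists_between hinit
  have hM : 0 < M := (hnonneg 0 le_rfl).trans_lt hvM
  have hc : 0 < 1 - lam * M ^ (β - α) := by
    have h := Real.rpow_lt_rpow hM.le hMu hd
    have hexp : -(1 / (β - α)) * (β - α) = -1 := by field_simp
    rw [← Real.rpow_mul hlam.le, hexp, Real.rpow_neg_one] at h
    have h' := mul_lt_mul_of_pos_left h hlam
    rw [mul_inv_cancel₀ hlam.ne'] at h'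
    linarith
  have hbound : ∀ t, 0 ≤ t → v t ≤ M := by
    intro t ht
    refine image_le_of_deriv_right_lt_deriv_boundary (a := 0) (b := t) (B := fun _ => M)
      (B' := fun _ => 0) (fun s hs => (hode s hs.1).continuousAt.continuousWithinAt)
      (fun s hs => (hode s hs.1).hasDerivWithinAt) hvM.le (fun s => hasDerivAt_const s M) ?_
      (Set.right_mem_Icc.2 ht)
    intro s hs hsM
    have h := mul_rpow_sub_rpow_le hα hαβ hlam (hnonneg s hs.1) hsM.le
    have hprod := mul_pos hc (Real.rpow_pos_of_pos hM α)
    rw [hsM] at h ⊢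
    linarith
  have hdecay : ∀ t, 0 ≤ t →
      lam * v t ^ β - v t ^ α ≤ -(1 - lam * M ^ (β - α)) * v t ^ α := fun t ht =>
    mul_rpow_sub_rpow_le hα hαβ hlam (hnonneg t ht) (hbound t ht)
  have hanti : AntitoneOn v (Set.Ici 0) := by
    refine antitoneOn_Ici_of_hasDerivAt_nonpos hode fun t ht => (hdecay t ht).trans ?_
    have hprod := mul_nonneg hc.le (Real.rpow_nonneg (hnonneg t ht) α)
    linarith
  obtain ⟨T, hT, hvT⟩ :=
    exists_eq_zero_of_deriv_le_neg_rpow (hαβ.trans_le hβ) hc hnonneg hode hdecay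
  have hzero : ∀ t, T ≤ t → v t = 0 := fun t ht =>
    le_antisymm (hvT ▸ hanti hT (hT.trans ht) ht) (hnonneg t (hT.trans ht))
  refine ⟨⟨T, hT, hzero⟩, tendsto_const_nhds.congr' ?_⟩
  filter_upwards [Filter.eventually_ge_atTop T] with t ht
  exact (hzero t ht).symm
end

section
/- Let N ≥ 1 be an integer and let α ∈ (0,1), μ > 0, ε > 0 be real numbers. Set ν = 2/(1−α). Let δ ≥ 1 be a real number with (N−1)(δ−1) < να + 1, and set K₃ = ( (μ/ν) / ((να+1) − (N−1)(δ−1)) )^{1/(1−α)}. Define η₂(r) = K₃·(δε − r)^ν for r ∈ [ε, δε]. Then for every r with ε ≤ r ≤ δε one has −η₂''(r) − ((N−1)/r)·η₂'(r) + μ·η₂(r)^α ≤ 0. -/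
theorem hasDerivAt_const_mul_sub_rpow (c a p : ℝ) (hp : 1 ≤ p) (r : ℝ) :
    HasDerivAt (fun r => c * (a - r) ^ p) (-(c * p) * (a - r) ^ (p - 1)) r := by
  have h := (((hasDerivAt_id r).const_sub a).rpow_const (p := p) (Or.inr hp)).const_mul c
  exact h.congr_deriv (by simp only [id]; ring)

/-- The radial profile `η₂(r) = K₃ (δε - r)^ν`, with `ν = 2/(1-α)` and `K₃`
chosen as in the paper, is a subsolution of `-Δη + μ η^α ≤ 0` on the annulus
`ε ≤ r ≤ δε`, where for radial functions `Δη(r) = η''(r) + ((N-1)/r) η'(r)`. -/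
theorem stmt_13 (N : ℕ) (hN : 1 ≤ N) (α μ ε δ : ℝ)
    (hα : α ∈ Set.Ioo (0 : ℝ) 1) (hμ : 0 < μ) (hε : 0 < ε) (hδ : 1 ≤ δ)
    (ν : ℝ) (hν : ν = 2 / (1 - α))
    (hδcond : ((N : ℝ) - 1) * (δ - 1) < ν * α + 1)
    (K₃ : ℝ) (hK₃ : K₃ = ((μ / ν) / ((ν * α + 1) - ((N : ℝ) - 1) * (δ - 1))) ^ (1 / (1 - α)))
    (η₂ : ℝ → ℝ) (hη₂ : ∀ r, η₂ r = K₃ * (δ * ε - r) ^ ν) :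
    ∀ r : ℝ, ε ≤ r → r ≤ δ * ε →
      -(deriv (deriv η₂) r) - (((N : ℝ) - 1) / r) * deriv η₂ r + μ * η₂ r ^ α ≤ 0 := by
  intro r hr₁ hr₂
  obtain ⟨hα₀, hα₁⟩ := hα
  have hα' : 0 < 1 - α := by linarith
  have hν₀ : 0 < ν := by rw [hν]; positivity
  have hνα : 0 < ν * α := mul_pos hν₀ hα₀
  have hν₂ : ν = ν * α + 2 := by
    have : ν * (1 - α) = 2 := by rw [hν]; field_simp
    linarith
  have hN' : (0 : ℝ) ≤ N - 1 := by
    have : (1 : ℝ) ≤ N := by exact_mod_cast hN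
    linarith
  have hr : 0 < r := hε.trans_le hr₁
  have hd₁ : deriv η₂ = fun r => -(K₃ * ν) * (δ * ε - r) ^ (ν - 1) := by
    funext s
    rw [funext hη₂]
    exact (hasDerivAt_const_mul_sub_rpow K₃ (δ * ε) ν (by linarith) s).deriv
  have hd₂ : deriv (deriv η₂) r = K₃ * ν * (ν * α + 1) * (δ * ε - r) ^ (ν * α) := by
    rw [hd₁, (hasDerivAt_const_mul_sub_rpow _ (δ * ε) (ν - 1) (by linarith) r).deriv,
      show ν - 1 - 1 = ν * α by linarith, show ν - 1 = ν * α + 1 by linarith]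
    ring
  set D := (ν * α + 1) - ((N : ℝ) - 1) * (δ - 1) with hD
  have hD₀ : 0 < D := by linarith
  have hB : 0 < μ / ν / D := by positivity
  have hK : 0 < K₃ := by rw [hK₃]; exact Real.rpow_pos_of_pos hB _
  have hKpow : K₃ ^ (1 - α) = μ / ν / D := by
    rw [hK₃, ← Real.rpow_mul hB.le, one_div_mul_cancel hα'.ne', Real.rpow_one]
  have hKeq : μ * K₃ ^ α = K₃ * ν * D := by
    have h : K₃ = K₃ ^ (1 - α) * K₃ ^ α := by
      rw [← Real.rpow_add hK]; simp
    rw [hKpow] at h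
    have h' : μ / ν / D * K₃ ^ α * ν * D = μ * K₃ ^ α := by field_simp
    rw [← h'] ; linear_combination (-ν * D) * h
  have ht : 0 ≤ δ * ε - r := by linarith
  have htr : (δ * ε - r) / r ≤ δ - 1 := by
    rw [div_le_iff₀ hr]
    nlinarith
  rw [hd₂, hd₁, hη₂, Real.mul_rpow hK.le (Real.rpow_nonneg ht _), ← Real.rpow_mul ht]
  beta_reduce
  rw [show ν - 1 = ν * α + 1 by linarith, Real.rpow_add_one' ht (by linarith)]
  have hT : 0 ≤ (δ * ε - r) ^ (ν * α) := Real.rpow_nonneg ht _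
  generalize (δ * ε - r) ^ (ν * α) = T at hT ⊢
  have key : 0 ≤ K₃ * ν * T * ((N - 1) * (δ - 1 - (δ * ε - r) / r)) :=
    mul_nonneg (by positivity) (mul_nonneg hN' (by linarith))
  calc _ = -(K₃ * ν * T * ((N - 1) * (δ - 1 - (δ * ε - r) / r))) := by
        rw [← mul_assoc μ, hKeq, hD]; ring
    _ ≤ 0 := by linarith
end
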